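/- arXiv:2102.01291 — 2 statements merged into one kernel-verified Lean document; each statement's English description precedes it below -/
import Mathlib

section
/- (Lemma 2, conservativeness of the Neyman-style variance estimator.) Under Assumptions 1, 2 and 3, with V*_{X̂} := Σ_{g∈𝒢} p_g^{-1} A_{0,g} S*_g A_{0,g}′ positive definite, the Neyman-style variance estimator σ̂*² converges in probability to σ*² + S*_θ, and S*_θ ≥ 0, so that the probability limit of σ̂*² is greater than or equal to the asymptotic variance σ*² of the plug-in efficient estimator, with equality if and only if S*_θ = 0. -/
open Finset Filter Topology Matrix MeasureTheory ProbabilityTheory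
open scoped BigOperators Classical ENNReal NNReal

noncomputable section

namespace Staggered

/-- Treatment dates: `ℕ∞ = ℕ ∪ {∞}`; `⊤` means never treated. -/
abbrev Date : Type := ℕ∞

/-- Period `t : Fin T` stands for calendar period `t + 1`; `periodLT t g` says that period `t`
is strictly earlier than the treatment date `g` (i.e. `g > t`). -/
def periodLT {T : ℕ} (t : Fin T) (g : Date) : Prop := (((t : ℕ) + 1 : ℕ) : Date) < g

/-- Assumption 1 sample space: the valid assignment vectors, i.e. those in which exactly
`Ng g` units have first-treatment date `g`, for every `g ∈ 𝒢`. -/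
def assigns (N : ℕ) (𝒢 : Finset Date) (Ng : Date → ℕ) : Finset (Fin N → 𝒢) :=
  Finset.univ.filter fun d => ∀ g ∈ 𝒢, (Finset.univ.filter fun i => (d i : Date) = g).card = Ng g

/-- Expectation under the uniform distribution on valid assignments (Assumption 1). -/
def expec (N : ℕ) (𝒢 : Finset Date) (Ng : Date → ℕ) (f : (Fin N → 𝒢) → ℝ) : ℝ :=
  (∑ d ∈ assigns N 𝒢 Ng, f d) / ((assigns N 𝒢 Ng).card : ℝ)

/-- Probability of an event under the uniform distribution on valid assignments. -/
def prob (N : ℕ) (𝒢 : Finset Date) (Ng : Date → ℕ) (p : (Fin N → 𝒢) → Prop) : ℝ :=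
  (((assigns N 𝒢 Ng).filter p).card : ℝ) / ((assigns N 𝒢 Ng).card : ℝ)

/-- Variance of a real statistic under the uniform distribution on valid assignments. -/
def varE (N : ℕ) (𝒢 : Finset Date) (Ng : Date → ℕ) (f : (Fin N → 𝒢) → ℝ) : ℝ :=
  expec N 𝒢 Ng fun d => (f d - expec N 𝒢 Ng f) ^ 2

/-- Covariance of two real statistics under the uniform distribution on valid assignments. -/
def covE (N : ℕ) (𝒢 : Finset Date) (Ng : Date → ℕ) (f h : (Fin N → 𝒢) → ℝ) : ℝ :=
  expec N 𝒢 Ng fun d => (f d - expec N 𝒢 Ng f) * (h d - expec N 𝒢 Ng h)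

/-- Observed outcome vectors `Y_i = Y_i(G_i)`. -/
def obs {N T : ℕ} {𝒢 : Finset Date} (Y : Fin N → Date → Fin T → ℝ) (d : Fin N → 𝒢) :
    Fin N → Fin T → ℝ := fun i => Y i (d i)

/-- Cohort sample mean `Ȳ_g` computed from outcome data `y` and assignment `d`. -/
def cmean {N T : ℕ} {𝒢 : Finset Date} (Ng : Date → ℕ) (y : Fin N → Fin T → ℝ)
    (d : Fin N → 𝒢) (g : Date) : Fin T → ℝ :=
  fun t => (∑ i, if (d i : Date) = g then y i t else 0) / (Ng g : ℝ)

/-- Finite-population mean of a scalar attribute. -/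
def popMeanS (N : ℕ) (w : Fin N → ℝ) : ℝ := (∑ i, w i) / (N : ℝ)

/-- Finite-population variance (normalized by `N - 1`) of a scalar attribute. -/
def popVarS (N : ℕ) (w : Fin N → ℝ) : ℝ :=
  (∑ i, (w i - popMeanS N w) ^ 2) / ((N : ℝ) - 1)

/-- Finite-population mean of a vector attribute. -/
def popMeanV (N K : ℕ) (W : Fin N → Fin K → ℝ) : Fin K → ℝ := fun k => (∑ i, W i k) / (N : ℝ)

/-- Finite-population covariance matrix (normalized by `N - 1`) of a vector attribute. -/
def popCov (N K : ℕ) (W : Fin N → Fin K → ℝ) : Matrix (Fin K) (Fin K) ℝ :=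
  Matrix.of fun k l =>
    (∑ i, (W i k - popMeanV N K W k) * (W i l - popMeanV N K W l)) / ((N : ℝ) - 1)

/-- Finite-population cross-covariance matrix of two vector attributes. -/
def popCrossCov (N K : ℕ) (W V : Fin N → Fin K → ℝ) : Matrix (Fin K) (Fin K) ℝ :=
  Matrix.of fun k l =>
    (∑ i, (W i k - popMeanV N K W k) * (V i l - popMeanV N K V l)) / ((N : ℝ) - 1)

/-- `S_g`: finite-population covariance matrix of the potential outcomes `Y(g)`. -/
def Sg (N T : ℕ) (Y : Fin N → Date → Fin T → ℝ) (g : Date) : Matrix (Fin T) (Fin T) ℝ :=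
  popCov N T fun i => Y i g

/-- `S_{gg'}`: finite-population cross-covariance of `Y(g)` and `Y(g')`. -/
def Sgg (N T : ℕ) (Y : Fin N → Date → Fin T → ℝ) (g g' : Date) : Matrix (Fin T) (Fin T) ℝ :=
  popCrossCov N T (fun i => Y i g) (fun i => Y i g')

/-- Average treatment contrast `τ_{t,gg'}`. -/
def tau (N T : ℕ) (Y : Fin N → Date → Fin T → ℝ) (t : Fin T) (g g' : Date) : ℝ :=
  (∑ i, (Y i g t - Y i g' t)) / (N : ℝ)

/-- Target parameter `θ = Σ_{t,g,g'} a_{t,gg'} τ_{t,gg'}`. -/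
def thetaParam (N T : ℕ) (𝒢 : Finset Date) (Y : Fin N → Date → Fin T → ℝ)
    (a : Fin T → Date → Date → ℝ) : ℝ :=
  ∑ t, ∑ g ∈ 𝒢, ∑ g' ∈ 𝒢, a t g g' * tau N T Y t g g'

/-- Sample analog `θ̂₀` computed from outcome data `y` and assignment `d`. -/
def thetaHat0 {N T : ℕ} (𝒢 : Finset Date) (Ng : Date → ℕ) (a : Fin T → Date → Date → ℝ)
    (y : Fin N → Fin T → ℝ) (d : Fin N → 𝒢) : ℝ :=
  ∑ t, ∑ g ∈ 𝒢, ∑ g' ∈ 𝒢, a t g g' * (cmean Ng y d g t - cmean Ng y d g' t)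

/-- The statistic `X̂` computed from outcome data `y` and assignment `d`. -/
def Xhat {N T M : ℕ} (𝒢 : Finset Date) (Ng : Date → ℕ)
    (b : Fin M → Fin T → Date → Date → ℝ) (y : Fin N → Fin T → ℝ) (d : Fin N → 𝒢) :
    Fin M → ℝ :=
  fun j => ∑ t, ∑ g ∈ 𝒢, ∑ g' ∈ 𝒢, b j t g g' * (cmean Ng y d g t - cmean Ng y d g' t)

/-- Induced row vector `A_{θ,g}` of weights on `Ȳ_g` in `θ̂₀`. -/
def Atheta (T : ℕ) (𝒢 : Finset Date) (a : Fin T → Date → Date → ℝ) (g : Date) :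
    Fin T → ℝ := fun t => ∑ g' ∈ 𝒢, (a t g g' - a t g' g)

/-- Induced `M × T` matrix `A_{0,g}` of weights on `Ȳ_g` in `X̂`. -/
def A0 (T M : ℕ) (𝒢 : Finset Date) (b : Fin M → Fin T → Date → Date → ℝ) (g : Date) :
    Matrix (Fin M) (Fin T) ℝ :=
  Matrix.of fun j t => ∑ g' ∈ 𝒢, (b j t g g' - b j t g' g)

/-- `S_θ`: finite-population variance of the unit-level scalars `Σ_g A_{θ,g} Y_i(g)`. -/
def Stheta (N T : ℕ) (𝒢 : Finset Date) (Y : Fin N → Date → Fin T → ℝ)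
    (a : Fin T → Date → Date → ℝ) : ℝ :=
  popVarS N fun i => ∑ g ∈ 𝒢, Atheta T 𝒢 a g ⬝ᵥ Y i g

/-- Within-cohort sample covariance `Ŝ_g` from outcome data `y` and assignment `d`. -/
def Shat {N T : ℕ} {𝒢 : Finset Date} (Ng : Date → ℕ) (y : Fin N → Fin T → ℝ)
    (d : Fin N → 𝒢) (g : Date) : Matrix (Fin T) (Fin T) ℝ :=
  Matrix.of fun t t' =>
    (∑ i, if (d i : Date) = g then
      (y i t - cmean Ng y d g t) * (y i t' - cmean Ng y d g t') else 0) / ((Ng g : ℝ) - 1)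

/-- Plug-in estimate `V̂_{X̂}`. -/
def VhatX {N T M : ℕ} (𝒢 : Finset Date) (Ng : Date → ℕ)
    (b : Fin M → Fin T → Date → Date → ℝ) (y : Fin N → Fin T → ℝ) (d : Fin N → 𝒢) :
    Matrix (Fin M) (Fin M) ℝ :=
  ∑ g ∈ 𝒢, ((Ng g : ℝ))⁻¹ • (A0 T M 𝒢 b g * Shat Ng y d g * (A0 T M 𝒢 b g)ᵀ)

/-- Plug-in estimate `V̂_{X̂,θ̂₀}`. -/
def VhatXtheta {N T M : ℕ} (𝒢 : Finset Date) (Ng : Date → ℕ)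
    (a : Fin T → Date → Date → ℝ) (b : Fin M → Fin T → Date → Date → ℝ)
    (y : Fin N → Fin T → ℝ) (d : Fin N → 𝒢) : Fin M → ℝ :=
  ∑ g ∈ 𝒢, ((Ng g : ℝ))⁻¹ • ((A0 T M 𝒢 b g * Shat Ng y d g).mulVec (Atheta T 𝒢 a g))

/-- Plug-in coefficient `β̂* = V̂_{X̂}⁻¹ V̂_{X̂,θ̂₀}`. -/
def betaHatStar {N T M : ℕ} (𝒢 : Finset Date) (Ng : Date → ℕ)
    (a : Fin T → Date → Date → ℝ) (b : Fin M → Fin T → Date → Date → ℝ)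
    (y : Fin N → Fin T → ℝ) (d : Fin N → 𝒢) : Fin M → ℝ :=
  (VhatX 𝒢 Ng b y d)⁻¹.mulVec (VhatXtheta 𝒢 Ng a b y d)

/-- Plug-in efficient estimator `θ̂_{β̂*} = θ̂₀ - X̂'β̂*`. -/
def thetaHatPlug {N T M : ℕ} (𝒢 : Finset Date) (Ng : Date → ℕ)
    (a : Fin T → Date → Date → ℝ) (b : Fin M → Fin T → Date → Date → ℝ)
    (y : Fin N → Fin T → ℝ) (d : Fin N → 𝒢) : ℝ :=
  thetaHat0 𝒢 Ng a y d - ∑ j, Xhat 𝒢 Ng b y d j * betaHatStar 𝒢 Ng a b y d j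

/-- Neyman-style variance estimator `σ̂*²`. -/
def sigmaSqNeyman {N T M : ℕ} (𝒢 : Finset Date) (Ng : Date → ℕ)
    (a : Fin T → Date → Date → ℝ) (b : Fin M → Fin T → Date → Date → ℝ)
    (y : Fin N → Fin T → ℝ) (d : Fin N → 𝒢) : ℝ :=
  (∑ g ∈ 𝒢, ((N : ℝ) / (Ng g : ℝ)) *
      (Atheta T 𝒢 a g ⬝ᵥ (Shat Ng y d g).mulVec (Atheta T 𝒢 a g)))
  - (∑ g ∈ 𝒢, ((N : ℝ) / (Ng g : ℝ)) •
        ((A0 T M 𝒢 b g * Shat Ng y d g).mulVec (Atheta T 𝒢 a g))) ⬝ᵥ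
    ((∑ g ∈ 𝒢, ((N : ℝ) / (Ng g : ℝ)) •
        (A0 T M 𝒢 b g * Shat Ng y d g * (A0 T M 𝒢 b g)ᵀ))⁻¹.mulVec
      (∑ g ∈ 𝒢, ((N : ℝ) / (Ng g : ℝ)) •
        ((A0 T M 𝒢 b g * Shat Ng y d g).mulVec (Atheta T 𝒢 a g))))

/-- The `(g_min - 1) × T` selection matrix `M` picking out the periods before `g_min`. -/
def Msel (T gmin : ℕ) : Matrix (Fin (gmin - 1)) (Fin T) ℝ :=
  Matrix.of fun k t => if (t : ℕ) = (k : ℕ) then 1 else 0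

/-- `β̂_g = (M Ŝ_g M')⁻¹ M Ŝ_g A_{θ,g}'`. -/
def betaHatg {N T : ℕ} {𝒢 : Finset Date} (Ng : Date → ℕ) (a : Fin T → Date → Date → ℝ)
    (gmin : ℕ) (y : Fin N → Fin T → ℝ) (d : Fin N → 𝒢) (g : Date) : Fin (gmin - 1) → ℝ :=
  (Msel T gmin * Shat Ng y d g * (Msel T gmin)ᵀ)⁻¹.mulVec
    ((Msel T gmin * Shat Ng y d g).mulVec (Atheta T 𝒢 a g))

/-- Refined variance estimator `σ̂**²`. -/
def sigmaSqRefined {N T M : ℕ} (𝒢 : Finset Date) (Ng : Date → ℕ)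
    (a : Fin T → Date → Date → ℝ) (b : Fin M → Fin T → Date → Date → ℝ) (gmin : ℕ)
    (y : Fin N → Fin T → ℝ) (d : Fin N → 𝒢) : ℝ :=
  sigmaSqNeyman 𝒢 Ng a b y d -
    (∑ g ∈ 𝒢.filter fun g => (gmin : Date) ≤ g, betaHatg Ng a gmin y d g) ⬝ᵥ
      ((Msel T gmin * Shat Ng y d (gmin : Date) * (Msel T gmin)ᵀ).mulVec
        (∑ g ∈ 𝒢.filter fun g => (gmin : Date) ≤ g, betaHatg Ng a gmin y d g))

/-- Studentized plug-in efficient statistic `t = θ̂_{β̂*} / (σ̂** / √N)`. -/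
def tstat {N T M : ℕ} (𝒢 : Finset Date) (Ng : Date → ℕ)
    (a : Fin T → Date → Date → ℝ) (b : Fin M → Fin T → Date → Date → ℝ) (gmin : ℕ)
    (y : Fin N → Fin T → ℝ) (d : Fin N → 𝒢) : ℝ :=
  thetaHatPlug 𝒢 Ng a b y d /
    (Real.sqrt (sigmaSqRefined 𝒢 Ng a b gmin y d) / Real.sqrt (N : ℝ))

/-- Fisher randomization test p-value for the statistic `stat`, based on observed data
`(Y(G), G)` and recomputing the statistic with permuted assignments. -/
def pFRT {N T : ℕ} {𝒢 : Finset Date} (stat : (Fin N → Fin T → ℝ) → (Fin N → 𝒢) → ℝ)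
    (Y : Fin N → Date → Fin T → ℝ) (d : Fin N → 𝒢) : ℝ :=
  (((Finset.univ : Finset (Equiv.Perm (Fin N))).filter fun π =>
      stat (obs Y d) (fun i => d (π i)) ≥ stat (obs Y d) d).card : ℝ) /
    ((Finset.univ : Finset (Equiv.Perm (Fin N))).card : ℝ)

/-- Limit covariance matrix `V*_{X̂}`. -/
def VstarX (T M : ℕ) (𝒢 : Finset Date) (b : Fin M → Fin T → Date → Date → ℝ)
    (p : Date → ℝ) (Sstar : Date → Matrix (Fin T) (Fin T) ℝ) : Matrix (Fin M) (Fin M) ℝ :=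
  ∑ g ∈ 𝒢, (p g)⁻¹ • (A0 T M 𝒢 b g * Sstar g * (A0 T M 𝒢 b g)ᵀ)

/-- Limit covariance vector `V*_{X̂,θ̂₀}`. -/
def VstarXtheta (T M : ℕ) (𝒢 : Finset Date) (a : Fin T → Date → Date → ℝ)
    (b : Fin M → Fin T → Date → Date → ℝ) (p : Date → ℝ)
    (Sstar : Date → Matrix (Fin T) (Fin T) ℝ) : Fin M → ℝ :=
  ∑ g ∈ 𝒢, (p g)⁻¹ • ((A0 T M 𝒢 b g * Sstar g).mulVec (Atheta T 𝒢 a g))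

/-- Limit variance `V*_{θ̂₀}`. -/
def VstarTheta (T : ℕ) (𝒢 : Finset Date) (a : Fin T → Date → Date → ℝ) (p : Date → ℝ)
    (Sstar : Date → Matrix (Fin T) (Fin T) ℝ) (Sthetastar : ℝ) : ℝ :=
  (∑ g ∈ 𝒢, (p g)⁻¹ * (Atheta T 𝒢 a g ⬝ᵥ (Sstar g).mulVec (Atheta T 𝒢 a g))) - Sthetastar

/-- Asymptotic variance `σ*²` of the (plug-in) efficient estimator. -/
def sigmaSqLim (T M : ℕ) (𝒢 : Finset Date) (a : Fin T → Date → Date → ℝ)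
    (b : Fin M → Fin T → Date → Date → ℝ) (p : Date → ℝ)
    (Sstar : Date → Matrix (Fin T) (Fin T) ℝ) (Sthetastar : ℝ) : ℝ :=
  VstarTheta T 𝒢 a p Sstar Sthetastar -
    VstarXtheta T M 𝒢 a b p Sstar ⬝ᵥ
      (VstarX T M 𝒢 b p Sstar)⁻¹.mulVec (VstarXtheta T M 𝒢 a b p Sstar)

/-- A bounded real function. -/
def IsBounded (f : ℝ → ℝ) : Prop := ∃ C, ∀ x, |f x| ≤ C

end Staggered

namespace Staggered

lemma prob_nonneg (N : ℕ) (𝒢 : Finset Date) (Ng : Date → ℕ) (p : (Fin N → 𝒢) → Prop) :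
    0 ≤ prob N 𝒢 Ng p := by
  unfold prob; positivity

lemma prob_mono (N : ℕ) (𝒢 : Finset Date) (Ng : Date → ℕ) (p q : (Fin N → 𝒢) → Prop)
    (h : ∀ d ∈ assigns N 𝒢 Ng, p d → q d) : prob N 𝒢 Ng p ≤ prob N 𝒢 Ng q := by
  unfold prob
  apply div_le_div_of_nonneg_right _ (by positivity)
  norm_cast
  apply Finset.card_le_card
  intro d hd
  simp only [Finset.mem_filter] at hd ⊢
  exact ⟨hd.1, h d hd.1 hd.2⟩

lemma prob_or (N : ℕ) (𝒢 : Finset Date) (Ng : Date → ℕ) (p q : (Fin N → 𝒢) → Prop) :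
    prob N 𝒢 Ng (fun d => p d ∨ q d) ≤ prob N 𝒢 Ng p + prob N 𝒢 Ng q := by
  unfold prob
  rw [← add_div]
  apply div_le_div_of_nonneg_right _ (by positivity)
  norm_cast
  refine le_trans (Finset.card_le_card ?_) (Finset.card_union_le _ _)
  intro d hd
  simp only [Finset.mem_union, Finset.mem_filter] at hd ⊢
  tauto

/-- The filter whose members have probability tending to one: convergence in probability is
`Tendsto` along this filter. -/
def probFilter (N : ℕ → ℕ) (𝒢 : Finset Date) (Ng : ℕ → Date → ℕ) :
    Filter (Σ m, (Fin (N m) → 𝒢)) where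
  sets := {s | Tendsto (fun m => prob (N m) 𝒢 (Ng m) fun d => (⟨m, d⟩ : Σ m, (Fin (N m) → 𝒢)) ∉ s)
    atTop (𝓝 0)}
  univ_sets := by simp [prob]
  sets_of_superset := by
    intro s t hs hst
    refine squeeze_zero (fun m => prob_nonneg _ _ _ _) (fun m => ?_) hs
    exact prob_mono _ _ _ _ _ fun d _ hd h => hd (hst h)
  inter_sets := by
    intro s t hs ht
    have hst := Tendsto.add hs ht
    rw [add_zero] at hst
    refine squeeze_zero (fun m => prob_nonneg _ _ _ _) (fun m => ?_) hst
    refine le_trans (prob_mono _ _ _ _ _ fun d _ hd => ?_) (prob_or _ _ _ _ _)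
    simp only [Set.mem_inter_iff, not_and_or] at hd
    exact hd

lemma mem_probFilter {N : ℕ → ℕ} {𝒢 : Finset Date} {Ng : ℕ → Date → ℕ}
    {s : Set (Σ m, (Fin (N m) → 𝒢))} :
    s ∈ probFilter N 𝒢 Ng ↔
    Tendsto (fun m => prob (N m) 𝒢 (Ng m) fun d => (⟨m, d⟩ : Σ m, (Fin (N m) → 𝒢)) ∉ s)
    atTop (𝓝 0) := Iff.rfl

lemma tendsto_fst (N : ℕ → ℕ) (𝒢 : Finset Date) (Ng : ℕ → Date → ℕ) :
    Tendsto (fun x : Σ m, (Fin (N m) → 𝒢) => x.1) (probFilter N 𝒢 Ng) atTop := by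
  intro s hs
  rw [Filter.mem_map, mem_probFilter]
  refine tendsto_const_nhds.congr' ?_
  filter_upwards [hs] with m hm
  simp [prob, hm]

lemma eventually_assigns (N : ℕ → ℕ) (𝒢 : Finset Date) (Ng : ℕ → Date → ℕ) :
    ∀ᶠ x in probFilter N 𝒢 Ng, x.2 ∈ assigns (N x.1) 𝒢 (Ng x.1) := by
  change _ ∈ _
  rw [mem_probFilter]
  refine squeeze_zero (g := fun _ => 0) (fun m => prob_nonneg _ _ _ _) (fun m => ?_)
    tendsto_const_nhds
  refine le_trans (prob_mono _ _ _ _ (fun _ => False) fun d hd h => h hd) ?_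
  simp [prob]

/-- joint selection count -/
def Qc (N : ℕ) (𝒢 : Finset Date) (Ng : Date → ℕ) (g : Date) (i j : Fin N) : ℝ :=
  ∑ d ∈ assigns N 𝒢 Ng, (if (d i : Date) = g then (1:ℝ) else 0) * (if (d j : Date) = g then 1 else 0)

lemma Qc_nonneg (N : ℕ) (𝒢 : Finset Date) (Ng : Date → ℕ) (g : Date) (i j : Fin N) :
    0 ≤ Qc N 𝒢 Ng g i j := by
  unfold Qc
  apply Finset.sum_nonneg
  intro d _
  split_ifs <;> simp

lemma comp_mem_assigns {N : ℕ} {𝒢 : Finset Date} {Ng : Date → ℕ} (σ : Equiv.Perm (Fin N))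
    {d : Fin N → 𝒢} (hd : d ∈ assigns N 𝒢 Ng) : d ∘ σ ∈ assigns N 𝒢 Ng := by
  simp only [assigns, Finset.mem_filter, Finset.mem_univ, true_and] at hd ⊢
  intro g hg
  rw [← hd g hg]
  refine Finset.card_bij (fun i _ => σ i) ?_ ?_ ?_
  · intro i hi
    simpa using hi
  · intro i _ j _ h
    exact σ.injective h
  · intro i hi
    refine ⟨σ.symm i, ?_, by simp⟩
    simpa using hi

lemma Qc_perm (N : ℕ) (𝒢 : Finset Date) (Ng : Date → ℕ) (g : Date) (i j : Fin N)
    (σ : Equiv.Perm (Fin N)) : Qc N 𝒢 Ng g (σ i) (σ j) = Qc N 𝒢 Ng g i j := by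
  unfold Qc
  refine Finset.sum_bij' (fun d _ => d ∘ σ) (fun d _ => d ∘ σ.symm) ?_ ?_ ?_ ?_ ?_
  · intro d hd; exact comp_mem_assigns σ hd
  · intro d hd; exact comp_mem_assigns σ.symm hd
  · intro d hd; ext; simp
  · intro d hd; ext; simp
  · intro d hd; simp

lemma Qc_diag (N : ℕ) (𝒢 : Finset Date) (Ng : Date → ℕ) (g : Date) (hg : g ∈ 𝒢) (i : Fin N) :
    (N : ℝ) * Qc N 𝒢 Ng g i i = (Ng g : ℝ) * ((assigns N 𝒢 Ng).card : ℝ) := by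
  have h1 : ∀ k, Qc N 𝒢 Ng g k k = Qc N 𝒢 Ng g i i := by
    intro k
    have := Qc_perm N 𝒢 Ng g i i (Equiv.swap i k)
    simpa using this
  have h2 : ∑ k, Qc N 𝒢 Ng g k k = (N : ℝ) * Qc N 𝒢 Ng g i i := by
    rw [Finset.sum_congr rfl (fun k _ => h1 k)]; simp
  rw [← h2]
  unfold Qc
  rw [Finset.sum_comm]
  rw [Finset.sum_congr rfl (g := fun _ => (Ng g : ℝ))]
  · simp [mul_comm]
  · intro d hd
    simp only [assigns, Finset.mem_filter, Finset.mem_univ, true_and] at hd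
    rw [← hd g hg, Finset.card_filter]
    push_cast
    apply Finset.sum_congr rfl
    intro k _
    split_ifs <;> simp

lemma second_moment (N : ℕ) (𝒢 : Finset Date) (Ng : Date → ℕ) (g : Date) (hg : g ∈ 𝒢)
    (hN : 0 < N) (z : Fin N → ℝ) (hz : ∑ i, z i = 0) :
    ∑ d ∈ assigns N 𝒢 Ng, (∑ i, if (d i : Date) = g then z i else 0) ^ 2 ≤
      ((Ng g : ℝ) / N * ∑ i, z i ^ 2) * ((assigns N 𝒢 Ng).card : ℝ) := by
  have e1 : ∑ d ∈ assigns N 𝒢 Ng, (∑ i, if (d i : Date) = g then z i else 0) ^ 2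
      = ∑ i, ∑ j, z i * z j * Qc N 𝒢 Ng g i j := by
    unfold Qc
    simp only [Finset.mul_sum]
    rw [Finset.sum_comm' (s := (Finset.univ : Finset (Fin N))) (t := fun _ => Finset.univ)
      (t' := Finset.univ) (s' := fun _ => Finset.univ) (by simp)]
    rw [Finset.sum_congr rfl (fun j _ => Finset.sum_comm)]
    rw [Finset.sum_comm]
    apply Finset.sum_congr rfl
    intro d _
    rw [sq, Finset.sum_mul_sum, Finset.sum_comm]
    apply Finset.sum_congr rfl; intro i _
    apply Finset.sum_congr rfl; intro j _
    split_ifs <;> simp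
  have e2 : ∀ i, ∑ j, z i * z j * Qc N 𝒢 Ng g i j ≤ z i ^ 2 * Qc N 𝒢 Ng g i i := by
    intro i
    rw [← Finset.add_sum_erase _ _ (Finset.mem_univ i)]
    have hz' : ∑ j ∈ Finset.univ.erase i, z j = - z i := by
      have := Finset.add_sum_erase _ z (Finset.mem_univ i)
      linarith
    rcases (Finset.univ.erase i).eq_empty_or_nonempty with h | ⟨k, hk⟩
    · rw [h]; simp [sq]
    · have hq : ∀ j ∈ Finset.univ.erase i, z i * z j * Qc N 𝒢 Ng g i j
          = z i * Qc N 𝒢 Ng g i k * z j := by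
        intro j hj
        have h := Qc_perm N 𝒢 Ng g i k (Equiv.swap k j)
        rw [Equiv.swap_apply_of_ne_of_ne (Finset.ne_of_mem_erase hk).symm
          (Finset.ne_of_mem_erase hj).symm, Equiv.swap_apply_left] at h
        rw [h]; ring
      rw [Finset.sum_congr rfl hq, ← Finset.mul_sum, hz']
      nlinarith [mul_nonneg (sq_nonneg (z i)) (Qc_nonneg N 𝒢 Ng g i k)]
  rw [e1]
  refine (Finset.sum_le_sum fun i _ => e2 i).trans (le_of_eq ?_)
  rw [Finset.mul_sum, Finset.sum_mul]
  apply Finset.sum_congr rfl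
  intro i _
  have h := Qc_diag N 𝒢 Ng g hg i
  have hN' : (N : ℝ) ≠ 0 := by positivity
  have h3 : Qc N 𝒢 Ng g i i = (Ng g : ℝ) * ((assigns N 𝒢 Ng).card : ℝ) / N := by
    field_simp; linarith
  rw [h3]; ring

lemma markov (N : ℕ) (𝒢 : Finset Date) (Ng : Date → ℕ) (X : (Fin N → 𝒢) → ℝ) (B ε : ℝ)
    (hε : 0 < ε) (hB : 0 ≤ B)
    (h : ∑ d ∈ assigns N 𝒢 Ng, X d ^ 2 ≤ B * ((assigns N 𝒢 Ng).card : ℝ)) :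
    prob N 𝒢 Ng (fun d => ε ≤ |X d|) ≤ B / ε ^ 2 := by
  unfold prob
  apply div_le_of_le_mul₀ (by positivity) (by positivity)
  have h1 : (((assigns N 𝒢 Ng).filter fun d => ε ≤ |X d|).card : ℝ) * ε ^ 2
      ≤ ∑ d ∈ assigns N 𝒢 Ng, X d ^ 2 := by
    calc _ = ∑ d ∈ (assigns N 𝒢 Ng).filter (fun d => ε ≤ |X d|), ε ^ 2 := by simp
      _ ≤ ∑ d ∈ (assigns N 𝒢 Ng).filter (fun d => ε ≤ |X d|), X d ^ 2 := by
        apply Finset.sum_le_sum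
        intro d hd
        rw [← sq_abs (X d)]
        have := (Finset.mem_filter.1 hd).2
        gcongr
      _ ≤ _ := Finset.sum_le_sum_of_subset_of_nonneg (Finset.filter_subset _ _)
        (fun _ _ _ => sq_nonneg _)
  rw [div_mul_eq_mul_div, le_div_iff₀ (by positivity)]
  linarith

/-- Weak law of large numbers for cohort means. -/
lemma wlln (N : ℕ → ℕ) (𝒢 : Finset Date) (Ng : ℕ → Date → ℕ) (g : Date) (hg : g ∈ 𝒢)
    (hN : ∀ m, 0 < N m) (hNg : ∀ m, 1 ≤ Ng m g) (z : ∀ m, Fin (N m) → ℝ)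
    (hB : Tendsto (fun m => (∑ i, z m i ^ 2) / ((Ng m g : ℝ) * N m)) atTop (𝓝 0)) (c : ℝ)
    (hc : Tendsto (fun m => (∑ i, z m i) / (N m : ℝ)) atTop (𝓝 c)) :
    Tendsto (fun x : Σ m, (Fin (N m) → 𝒢) =>
      (∑ i, if (x.2 i : Date) = g then z x.1 i else 0) / (Ng x.1 g : ℝ))
      (probFilter N 𝒢 Ng) (𝓝 c) := by
  set μ : ℕ → ℝ := fun m => (∑ i, z m i) / (N m : ℝ) with hμ
  have key : Tendsto (fun x : Σ m, (Fin (N m) → 𝒢) =>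
      (∑ i, if (x.2 i : Date) = g then z x.1 i - μ x.1 else 0) / (Ng x.1 g : ℝ))
      (probFilter N 𝒢 Ng) (𝓝 0) := by
    rw [Metric.tendsto_nhds]
    intro ε hε
    change _ ∈ _
    rw [mem_probFilter]
    have hB2 := hB.div_const (ε ^ 2)
    rw [zero_div] at hB2
    refine squeeze_zero (fun m => prob_nonneg _ _ _ _) (fun m => ?_) hB2
    refine le_trans (prob_mono _ _ _ _ (fun d => ε ≤
      |(∑ i, if (d i : Date) = g then z m i - μ m else 0) / (Ng m g : ℝ)|) ?_)
      (markov _ _ _ _ _ ε hε ?_ ?_)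
    · intro d _ hd
      by_contra hcon
      apply hd
      change dist _ _ < ε
      rw [Real.dist_eq, sub_zero]
      exact not_le.1 hcon
    · positivity
    · have hn : (0:ℝ) < N m := by exact_mod_cast hN m
      have hng : (0:ℝ) < Ng m g := by exact_mod_cast hNg m
      have hs : ∑ i, (z m i - μ m) = 0 := by
        rw [Finset.sum_sub_distrib]; simp [hμ]; field_simp; simp
      have h := second_moment (N m) 𝒢 (Ng m) g hg (hN m) (fun i => z m i - μ m) hs
      have hv : ∑ i, (z m i - μ m) ^ 2 ≤ ∑ i, z m i ^ 2 := by
        have e : ∑ i, z m i ^ 2 = ∑ i, (z m i - μ m) ^ 2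
            + 2 * μ m * ∑ i, (z m i - μ m) + ∑ i : Fin (N m), μ m ^ 2 := by
          rw [Finset.mul_sum, ← Finset.sum_add_distrib, ← Finset.sum_add_distrib]
          apply Finset.sum_congr rfl; intro i _; ring
        rw [e, hs]
        have : 0 ≤ ∑ i : Fin (N m), μ m ^ 2 := Finset.sum_nonneg fun _ _ => sq_nonneg _
        linarith
      simp only [div_pow]
      rw [← Finset.sum_div, div_le_iff₀ (by positivity)]
      refine h.trans ?_
      have e3 : (∑ i, z m i ^ 2) / ((Ng m g : ℝ) * N m) * ((assigns (N m) 𝒢 (Ng m)).card : ℝ)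
          * (Ng m g : ℝ) ^ 2 = ((Ng m g : ℝ) / N m * ∑ i, z m i ^ 2) *
          ((assigns (N m) 𝒢 (Ng m)).card : ℝ) := by
        field_simp
      rw [e3]
      gcongr
  have h2 := key.add (hc.comp (tendsto_fst N 𝒢 Ng))
  rw [zero_add] at h2
  refine h2.congr' ?_
  filter_upwards [eventually_assigns N 𝒢 Ng] with x hx
  have hng : (0:ℝ) < Ng x.1 g := by exact_mod_cast hNg x.1
  simp only [assigns, Finset.mem_filter, Finset.mem_univ, true_and] at hx
  have e : (∑ i, if (x.2 i : Date) = g then z x.1 i - μ x.1 else 0)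
      = (∑ i, if (x.2 i : Date) = g then z x.1 i else 0) - Ng x.1 g * μ x.1 := by
    rw [← hx g hg]
    have : ((Finset.univ.filter fun i => (x.2 i : Date) = g).card : ℝ) * μ x.1
      = ∑ i, if (x.2 i : Date) = g then μ x.1 else 0 := by
      rw [← Finset.sum_filter]; simp
    rw [this, ← Finset.sum_sub_distrib]
    apply Finset.sum_congr rfl; intro i _
    split_ifs <;> simp
  rw [e]
  simp only [Function.comp]
  field_simp
  simp [hμ]

lemma Shat_eq {N T : ℕ} {𝒢 : Finset Date} (Ng : Date → ℕ) (Y : Fin N → Date → Fin T → ℝ)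
    (d : Fin N → 𝒢) (hd : d ∈ assigns N 𝒢 Ng) (g : Date) (hg : g ∈ 𝒢) (hNg : 1 ≤ Ng g)
    (t t' : Fin T) (c c' : ℝ) :
    Shat Ng (obs Y d) d g t t' = (1 - (Ng g : ℝ)⁻¹)⁻¹ *
      ((∑ i, if (d i : Date) = g then (Y i g t - c) * (Y i g t' - c') else 0) / (Ng g : ℝ) -
      (∑ i, if (d i : Date) = g then (Y i g t - c) else 0) / (Ng g : ℝ) *
      ((∑ i, if (d i : Date) = g then (Y i g t' - c') else 0) / (Ng g : ℝ))) := by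
  have hng : (0:ℝ) < Ng g := by exact_mod_cast hNg
  simp only [assigns, Finset.mem_filter, Finset.mem_univ, true_and] at hd
  have hcard := hd g hg
  have hm : ∀ (t : Fin T), cmean Ng (obs Y d) d g t =
      (∑ i ∈ Finset.univ.filter fun i => (d i : Date) = g, Y i g t) / (Ng g : ℝ) := by
    intro t
    unfold cmean obs
    rw [← Finset.sum_filter]
    congr 1
    apply Finset.sum_congr rfl
    intro i hi
    rw [(Finset.mem_filter.1 hi).2]
  unfold Shat
  simp only [Matrix.of_apply]
  rw [← Finset.sum_filter, ← Finset.sum_filter, ← Finset.sum_filter, ← Finset.sum_filter]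
  rw [hm t, hm t']
  generalize hF : (Finset.univ.filter fun i => (d i : Date) = g) = F at *
  have e1 : ∑ i ∈ F, (obs Y d i t - (∑ i ∈ F, Y i g t) / (Ng g : ℝ)) *
      (obs Y d i t' - (∑ i ∈ F, Y i g t') / (Ng g : ℝ)) =
      ∑ i ∈ F, (Y i g t - (∑ i ∈ F, Y i g t) / (Ng g : ℝ)) *
      (Y i g t' - (∑ i ∈ F, Y i g t') / (Ng g : ℝ)) := by
    apply Finset.sum_congr rfl
    intro i hi
    rw [← hF] at hi
    unfold obs
    rw [(Finset.mem_filter.1 hi).2]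
  rw [e1]
  have hc : (F.card : ℝ) = Ng g := by exact_mod_cast hcard
  have e2 : ∀ (u v : ℝ), ∑ i ∈ F, (Y i g t - u) * (Y i g t' - v) = ∑ i ∈ F, Y i g t * Y i g t'
      - u * ∑ i ∈ F, Y i g t' - v * ∑ i ∈ F, Y i g t + Ng g * (u * v) := by
    intro u v
    rw [← hc, Finset.mul_sum, Finset.mul_sum, ← nsmul_eq_mul, ← Finset.sum_const,
      ← Finset.sum_sub_distrib, ← Finset.sum_sub_distrib, ← Finset.sum_add_distrib]
    apply Finset.sum_congr rfl; intro i _; ring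
  rw [e2, e2]
  simp only [Finset.sum_sub_distrib, Finset.sum_const, nsmul_eq_mul, hc]
  have e3 : (1 - (Ng g : ℝ)⁻¹)⁻¹ = Ng g * ((Ng g : ℝ) - 1)⁻¹ := by
    have : 1 - (Ng g : ℝ)⁻¹ = ((Ng g : ℝ) - 1) * (Ng g : ℝ)⁻¹ := by field_simp
    rw [this, mul_inv, inv_inv, mul_comm]
  rw [e3, div_eq_mul_inv _ ((Ng g : ℝ) - 1)]
  generalize ((Ng g : ℝ) - 1)⁻¹ = r
  field_simp
  ring

lemma tendsto_matrix_inv {α : Type*} {l : Filter α} {M : ℕ}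
    {A : α → Matrix (Fin M) (Fin M) ℝ} {B : Matrix (Fin M) (Fin M) ℝ}
    (h : Tendsto A l (𝓝 B)) (hB : B.det ≠ 0) : Tendsto (fun x => (A x)⁻¹) l (𝓝 B⁻¹) := by
  simp only [Matrix.inv_def, Ring.inverse_eq_inv']
  have hd : Tendsto (fun x => (A x).det) l (𝓝 B.det) :=
    ((continuous_id.matrix_det).tendsto B).comp h
  have ha : Tendsto (fun x => (A x).adjugate) l (𝓝 B.adjugate) :=
    ((continuous_id.matrix_adjugate).tendsto B).comp h
  exact (hd.inv₀ hB).smul ha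


/-- **Lemma 2, conservativeness of the Neyman-style variance estimator.**
Under Assumptions 1, 2, 3 with `V*_{X̂}` positive definite, `σ̂*²` converges in probability
to `σ*² + S*_θ ≥ σ*²`, with equality iff `S*_θ = 0`. -/
theorem statement13
    (T M : ℕ) (𝒢 : Finset Date) (N : ℕ → ℕ) (Ng : ℕ → Date → ℕ)
    (Y : ∀ m, Fin (N m) → Date → Fin T → ℝ)
    (a : Fin T → Date → Date → ℝ) (b : Fin M → Fin T → Date → Date → ℝ)
    (p : Date → ℝ) (Sstar : Date → Matrix (Fin T) (Fin T) ℝ)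
    (SstarCross : Date → Date → Matrix (Fin T) (Fin T) ℝ) (Sthetastar : ℝ)
    (hN2 : ∀ m, 2 ≤ N m) (hNtop : Tendsto N atTop atTop)
    (h𝒢ne : 𝒢.Nonempty) (h𝒢 : ∀ g ∈ 𝒢, (1 ≤ g ∧ g ≤ (T : Date)) ∨ g = ⊤)
    (hNg : ∀ m, ∀ g ∈ 𝒢, 1 ≤ Ng m g) (hsum : ∀ m, ∑ g ∈ 𝒢, Ng m g = N m)
    (hNA : ∀ m (i : Fin (N m)) (t : Fin T), ∀ g ∈ 𝒢, ∀ g' ∈ 𝒢,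
      periodLT t g → periodLT t g' → Y m i g t = Y m i g' t)
    (hb : ∀ (j : Fin M) (t : Fin T) (g g' : Date),
      b j t g g' ≠ 0 → periodLT t g ∧ periodLT t g')
    (hp : ∀ g ∈ 𝒢, 0 < p g ∧ p g < 1)
    (hpconv : ∀ g ∈ 𝒢, Tendsto (fun m => (Ng m g : ℝ) / (N m : ℝ)) atTop (𝓝 (p g)))
    (hSconv : ∀ g ∈ 𝒢, ∀ t t' : Fin T,
      Tendsto (fun m => Sg (N m) T (Y m) g t t') atTop (𝓝 (Sstar g t t')))
    (hScross : ∀ g ∈ 𝒢, ∀ g' ∈ 𝒢, ∀ t t' : Fin T,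
      Tendsto (fun m => Sgg (N m) T (Y m) g g' t t') atTop (𝓝 (SstarCross g g' t t')))
    (hSpd : ∀ g ∈ 𝒢, (Sstar g).PosDef)
    (hLind : ∀ ε > (0 : ℝ), ∀ᶠ m in atTop, ∀ (i : Fin (N m)), ∀ g ∈ 𝒢,
      (∑ t, (Y m i g t - popMeanS (N m) fun i' => Y m i' g t) ^ 2) / (N m : ℝ) < ε)
    (hSthetaconv : Tendsto (fun m => Stheta (N m) T 𝒢 (Y m) a) atTop (𝓝 Sthetastar))
    (hVXpd : (VstarX T M 𝒢 b p Sstar).PosDef) :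
    (∀ ε > (0 : ℝ),
      Tendsto (fun m => prob (N m) 𝒢 (Ng m) fun d =>
          ε < |sigmaSqNeyman 𝒢 (Ng m) a b (obs (Y m) d) d -
            (sigmaSqLim T M 𝒢 a b p Sstar Sthetastar + Sthetastar)|)
        atTop (𝓝 0)) ∧
    0 ≤ Sthetastar ∧
    sigmaSqLim T M 𝒢 a b p Sstar Sthetastar ≤
      sigmaSqLim T M 𝒢 a b p Sstar Sthetastar + Sthetastar ∧
    (sigmaSqLim T M 𝒢 a b p Sstar Sthetastar + Sthetastar =
        sigmaSqLim T M 𝒢 a b p Sstar Sthetastar ↔ Sthetastar = 0) := by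
  have hNpos : ∀ m, 0 < N m := fun m => lt_of_lt_of_le (by norm_num) (hN2 m)
  have hNR : Tendsto (fun m => (N m : ℝ)) atTop atTop := tendsto_natCast_atTop_atTop.comp hNtop
  have hNinv : Tendsto (fun m => (N m : ℝ)⁻¹) atTop (𝓝 0) := tendsto_inv_atTop_zero.comp hNR
  have hratio : ∀ g ∈ 𝒢, Tendsto (fun m => (N m : ℝ) / (Ng m g : ℝ)) atTop (𝓝 (p g)⁻¹) := by
    intro g hg
    refine ((hpconv g hg).inv₀ (hp g hg).1.ne').congr fun m => ?_
    rw [inv_div]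
  have hNginv : ∀ g ∈ 𝒢, Tendsto (fun m => (Ng m g : ℝ)⁻¹) atTop (𝓝 0) := by
    intro g hg
    have h := (hratio g hg).mul hNinv
    rw [mul_zero] at h
    refine h.congr fun m => ?_
    have : (N m : ℝ) ≠ 0 := by exact_mod_cast (hNpos m).ne'
    field_simp
  have hfrac : Tendsto (fun m => ((N m : ℝ) - 1) / N m) atTop (𝓝 1) := by
    have h := hNinv.const_sub 1
    rw [sub_zero] at h
    refine h.congr fun m => ?_
    have : (N m : ℝ) ≠ 0 := by exact_mod_cast (hNpos m).ne'
    field_simp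
  have hN1 : ∀ m, (0:ℝ) < (N m : ℝ) - 1 := by
    intro m
    have : (2:ℝ) ≤ N m := by exact_mod_cast hN2 m
    linarith
  -- centred outcomes
  let w : ∀ m, Date → Fin T → Fin (N m) → ℝ := fun m g t i => Y m i g t - popMeanV (N m) T (fun i => Y m i g) t
  have hsumw : ∀ g ∈ 𝒢, ∀ t t', Tendsto (fun m => (∑ i, w m g t i * w m g t' i) / (N m : ℝ)) atTop
      (𝓝 (Sstar g t t')) := by
    intro g hg t t'
    have h := (hSconv g hg t t').mul hfrac
    rw [mul_one] at h
    refine h.congr fun m => ?_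
    have h1 : (N m : ℝ) ≠ 0 := by exact_mod_cast (hNpos m).ne'
    have h2 := (hN1 m).ne'
    simp only [Sg, popCov, Matrix.of_apply, w]
    field_simp
  have hSig0 : ∀ g ∈ 𝒢, ∀ t, Tendsto (fun m => (∑ i, w m g t i ^ 2) / ((Ng m g : ℝ) * N m)) atTop
      (𝓝 0) := by
    intro g hg t
    have h := (hNginv g hg).mul (hsumw g hg t t)
    rw [zero_mul] at h
    refine h.congr fun m => ?_
    simp only [sq]
    rw [div_mul_eq_div_div_swap, div_eq_mul_inv _ (Ng m g : ℝ), mul_comm]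
  have hmean0 : ∀ g t, Tendsto (fun m => (∑ i, w m g t i) / (N m : ℝ)) atTop (𝓝 0) := by
    intro g t
    refine tendsto_const_nhds.congr fun m => ?_
    have h1 : (N m : ℝ) ≠ 0 := by exact_mod_cast (hNpos m).ne'
    have : ∑ i, w m g t i = 0 := by
      simp only [w, Finset.sum_sub_distrib, popMeanV]
      simp
      field_simp
      simp
    rw [this, zero_div]
  have hSig2 : ∀ g ∈ 𝒢, ∀ t t', Tendsto (fun m => (∑ i, (w m g t i * w m g t' i) ^ 2) /
      ((Ng m g : ℝ) * N m)) atTop (𝓝 0) := by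
    intro g hg t t'
    have hq := (hratio g hg).mul (hsumw g hg t' t')
    have hqb := hq.eventually (gt_mem_nhds (lt_add_one _))
    set K := (p g)⁻¹ * Sstar g t' t' + 1 with hK
    rw [Metric.tendsto_nhds]
    intro ε hε
    have hK' : 0 < |K| + 1 := by positivity
    filter_upwards [hqb, hLind (ε / (|K| + 1)) (by positivity)] with m hm1 hm2
    have h1 : (0:ℝ) < N m := by exact_mod_cast hNpos m
    have h2 : (0:ℝ) < Ng m g := by exact_mod_cast hNg m g hg
    have hnn : 0 ≤ (∑ i, (w m g t i * w m g t' i) ^ 2) / ((Ng m g : ℝ) * N m) := by positivity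
    rw [Real.dist_eq, sub_zero, abs_of_nonneg hnn]
    have hwb : ∀ i, w m g t i ^ 2 ≤ ε / (|K| + 1) * N m := by
      intro i
      have h3 := hm2 i g hg
      rw [div_lt_iff₀ h1] at h3
      refine le_trans ?_ h3.le
      exact Finset.single_le_sum (f := fun t => (Y m i g t - popMeanS (N m) fun i' => Y m i' g t) ^ 2)
        (fun _ _ => sq_nonneg _) (Finset.mem_univ t)
    have hs : ∑ i, (w m g t i * w m g t' i) ^ 2 ≤
        ε / (|K| + 1) * N m * ∑ i, w m g t' i * w m g t' i := by
      rw [Finset.mul_sum]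
      apply Finset.sum_le_sum
      intro i _
      rw [mul_pow, sq (w m g t' i)]
      exact mul_le_mul_of_nonneg_right (hwb i) (mul_self_nonneg _)
    have hs2 : (∑ i, (w m g t i * w m g t' i) ^ 2) / ((Ng m g : ℝ) * N m) ≤
        ε / (|K| + 1) * ((N m : ℝ) / (Ng m g : ℝ) * ((∑ i, w m g t' i * w m g t' i) / (N m : ℝ))) := by
      rw [div_le_iff₀ (by positivity)]
      refine hs.trans (le_of_eq ?_)
      field_simp
    refine lt_of_le_of_lt hs2 ?_
    have h5 : ε / (|K| + 1) * ((N m : ℝ) / (Ng m g : ℝ) * ((∑ i, w m g t' i * w m g t' i) / (N m : ℝ)))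
        < ε / (|K| + 1) * (|K| + 1) := by
      apply mul_lt_mul_of_pos_left _ (by positivity)
      linarith [le_abs_self K]
    rwa [div_mul_cancel₀ _ hK'.ne'] at h5
  have hShat : ∀ g ∈ 𝒢, Tendsto (fun x : Σ m, (Fin (N m) → 𝒢) =>
      Shat (Ng x.1) (obs (Y x.1) x.2) x.2 g) (probFilter N 𝒢 Ng) (𝓝 (Sstar g)) := by
    intro g hg
    refine tendsto_pi_nhds.2 fun t => tendsto_pi_nhds.2 fun t' => ?_
    have l1 := wlln N 𝒢 Ng g hg hNpos (fun m => hNg m g hg)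
      (fun m i => w m g t i * w m g t' i) (hSig2 g hg t t') _ (hsumw g hg t t')
    have l2 := fun t => wlln N 𝒢 Ng g hg hNpos (fun m => hNg m g hg)
      (fun m i => w m g t i) (hSig0 g hg t) _ (hmean0 g t)
    have l3 : Tendsto (fun m => (1 - (Ng m g : ℝ)⁻¹)⁻¹) atTop (𝓝 1) := by
      have h := ((hNginv g hg).const_sub 1).inv₀ (by norm_num)
      simpa using h
    have l4 := (l3.comp (tendsto_fst N 𝒢 Ng)).mul (l1.sub ((l2 t).mul (l2 t')))
    rw [mul_zero, sub_zero, one_mul] at l4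
    refine l4.congr' ?_
    filter_upwards [eventually_assigns N 𝒢 Ng] with x hx
    rw [Shat_eq (Ng x.1) (Y x.1) x.2 hx g hg (hNg x.1 g hg) t t' _ _]
    rfl
  have hr : ∀ g ∈ 𝒢, Tendsto (fun x : Σ m, (Fin (N m) → 𝒢) => (N x.1 : ℝ) / (Ng x.1 g : ℝ))
      (probFilter N 𝒢 Ng) (𝓝 (p g)⁻¹) := fun g hg => (hratio g hg).comp (tendsto_fst N 𝒢 Ng)
  have hmain : Tendsto (fun x : Σ m, (Fin (N m) → 𝒢) =>
      sigmaSqNeyman 𝒢 (Ng x.1) a b (obs (Y x.1) x.2) x.2) (probFilter N 𝒢 Ng)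
      (𝓝 (sigmaSqLim T M 𝒢 a b p Sstar Sthetastar + Sthetastar)) := by
    have c1 : Tendsto (fun x : Σ m, (Fin (N m) → 𝒢) =>
        ∑ g ∈ 𝒢, ((N x.1 : ℝ) / (Ng x.1 g : ℝ)) * (Atheta T 𝒢 a g ⬝ᵥ
          (Shat (Ng x.1) (obs (Y x.1) x.2) x.2 g).mulVec (Atheta T 𝒢 a g))) (probFilter N 𝒢 Ng)
        (𝓝 (∑ g ∈ 𝒢, (p g)⁻¹ * (Atheta T 𝒢 a g ⬝ᵥ (Sstar g).mulVec (Atheta T 𝒢 a g)))) := by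
      refine tendsto_finsetSum _ fun g hg => (hr g hg).mul ?_
      have hc : Continuous fun S : Matrix (Fin T) (Fin T) ℝ =>
        Atheta T 𝒢 a g ⬝ᵥ S.mulVec (Atheta T 𝒢 a g) := by fun_prop
      exact (hc.tendsto _).comp (hShat g hg)
    have c2 : Tendsto (fun x : Σ m, (Fin (N m) → 𝒢) =>
        ∑ g ∈ 𝒢, ((N x.1 : ℝ) / (Ng x.1 g : ℝ)) • ((A0 T M 𝒢 b g *
          Shat (Ng x.1) (obs (Y x.1) x.2) x.2 g).mulVec (Atheta T 𝒢 a g))) (probFilter N 𝒢 Ng)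
        (𝓝 (VstarXtheta T M 𝒢 a b p Sstar)) := by
      refine tendsto_finsetSum _ fun g hg => (hr g hg).smul ?_
      have hc : Continuous fun S : Matrix (Fin T) (Fin T) ℝ =>
        (A0 T M 𝒢 b g * S).mulVec (Atheta T 𝒢 a g) := by fun_prop
      exact (hc.tendsto _).comp (hShat g hg)
    have c3 : Tendsto (fun x : Σ m, (Fin (N m) → 𝒢) =>
        ∑ g ∈ 𝒢, ((N x.1 : ℝ) / (Ng x.1 g : ℝ)) • (A0 T M 𝒢 b g *
          Shat (Ng x.1) (obs (Y x.1) x.2) x.2 g * (A0 T M 𝒢 b g)ᵀ)) (probFilter N 𝒢 Ng)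
        (𝓝 (VstarX T M 𝒢 b p Sstar)) := by
      refine tendsto_finsetSum _ fun g hg => (hr g hg).smul ?_
      have hc : Continuous fun S : Matrix (Fin T) (Fin T) ℝ =>
        A0 T M 𝒢 b g * S * (A0 T M 𝒢 b g)ᵀ := by fun_prop
      exact (hc.tendsto _).comp (hShat g hg)
    have c4 := tendsto_matrix_inv c3 hVXpd.det_pos.ne'
    have hc : Continuous fun q : (Fin M → ℝ) × Matrix (Fin M) (Fin M) ℝ =>
        q.1 ⬝ᵥ q.2.mulVec q.1 := by fun_prop
    have c5 := c1.sub ((hc.tendsto _).comp (c2.prodMk_nhds c4))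
    have e : sigmaSqLim T M 𝒢 a b p Sstar Sthetastar + Sthetastar =
        (∑ g ∈ 𝒢, (p g)⁻¹ * (Atheta T 𝒢 a g ⬝ᵥ (Sstar g).mulVec (Atheta T 𝒢 a g))) -
        VstarXtheta T M 𝒢 a b p Sstar ⬝ᵥ
      (VstarX T M 𝒢 b p Sstar)⁻¹.mulVec (VstarXtheta T M 𝒢 a b p Sstar) := by
      unfold sigmaSqLim VstarTheta; ring
    rw [e]
    exact c5
  have hpos : 0 ≤ Sthetastar := by
    refine ge_of_tendsto' hSthetaconv fun m => ?_
    unfold Stheta popVarS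
    exact div_nonneg (Finset.sum_nonneg fun _ _ => sq_nonneg _) (hN1 m).le
  refine ⟨?_, hpos, by linarith, by constructor <;> intro h <;> linarith⟩
  intro ε hε
  have h := Metric.tendsto_nhds.1 hmain ε hε
  change _ ∈ _ at h
  rw [mem_probFilter] at h
  refine squeeze_zero (fun m => prob_nonneg _ _ _ _) (fun m => ?_) h
  refine prob_mono _ _ _ _ _ fun d _ hd => ?_
  simp only [Set.mem_ofPred_eq, Real.dist_eq, not_lt]
  exact hd.le

end Staggered
end
end

section
/- (Two-period optimal coefficient.) In the two-period special case T = 2 and 𝒢 = {2, ∞} with cohort sizes N_2, N_∞ ≥ 1 and N = N_2 + N_∞, suppose Assumptions 1 and 2 hold, so that Y_{i1}(2) = Y_{i1}(∞) =: Y_{i1} for every unit i, and suppose s₁² := (N−1)^{-1} Σ_i (Y_{i1} − E_N[Y_1])² > 0. Let θ̂₀ := Ȳ_{22} − Ȳ_{2∞} (post-treatment difference in means) and X̂ := Ȳ_{12} − Ȳ_{1∞} (pre-treatment difference in means, a scalar). Then the variance-minimizing coefficient β* := Var(X̂)^{-1} Cov(X̂, θ̂₀) equals (N_∞/N)·β_2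 + (N_2/N)·β_∞, where for g ∈ {2, ∞}, β_g := s₁^{-2} · (N−1)^{-1} Σ_i (Y_{i1} − E_N[Y_1])(Y_{i2}(g) − E_N[Y_2(g)]) is the finite-population regression coefficient of Y_{i2}(g) on Y_{i1}. -/
open Finset Filter Topology Matrix MeasureTheory ProbabilityTheory
open scoped BigOperators Classical ENNReal NNReal

noncomputable section

namespace Staggered

lemma sum_core {α : Type*} (S : Finset α) (hS : S.Nonempty) (N : ℕ) (hN : 2 ≤ N)
    (n : ℝ) (hn : 0 < n) (hnN : n < N) (z : α → Fin N → ℝ)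
    (hz : ∀ d ∈ S, ∑ i, z d i = n) (hzz : ∀ d i, z d i * z d i = z d i)
    (h1 : ∀ i j, ∑ d ∈ S, z d i = ∑ d ∈ S, z d j)
    (h2 : ∀ i j k l, i ≠ j → k ≠ l → ∑ d ∈ S, z d i * z d j = ∑ d ∈ S, z d k * z d l) :
    ∃ K : ℝ, 0 < K ∧ ∀ u v : Fin N → ℝ, ∑ i, u i = 0 → ∑ i, v i = 0 →
      (∑ d ∈ S, ∑ i, z d i * u i = 0) ∧
      (∑ d ∈ S, (∑ i, z d i * u i) * (∑ i, z d i * v i) = K * ∑ i, u i * v i) := by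
  have hc : (0 : ℝ) < S.card := by exact_mod_cast hS.card_pos
  have hNr : (2 : ℝ) ≤ N := by exact_mod_cast hN
  let i0 : Fin N := ⟨0, by omega⟩
  let i1 : Fin N := ⟨1, by omega⟩
  have h01 : i0 ≠ i1 := by
    intro h
    exact absurd (congrArg Fin.val h) zero_ne_one
  set p := ∑ d ∈ S, z d i0 with hp
  set q := ∑ d ∈ S, z d i0 * z d i1 with hq
  have hpi : ∀ i, ∑ d ∈ S, z d i = p := fun i => h1 i i0
  have hqij : ∀ i j, ∑ d ∈ S, z d i * z d j = q + if i = j then p - q else 0 := by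
    intro i j
    by_cases h : i = j
    · subst h
      simp only [hzz, if_true]
      rw [hpi]; ring
    · simp only [h, if_false, add_zero]
      exact h2 _ _ _ _ h h01
  have e1 : N * p = n * S.card := by
    have : ∑ i, ∑ d ∈ S, z d i = n * S.card := by
      rw [Finset.sum_comm, Finset.sum_congr rfl hz, Finset.sum_const, nsmul_eq_mul, mul_comm]
    simpa [hpi] using this
  have e2 : N * q + (p - q) = n * p := by
    have : ∑ j, ∑ d ∈ S, z d i0 * z d j = n * p := by
      rw [Finset.sum_comm, hp, Finset.mul_sum]
      refine Finset.sum_congr rfl fun d hd => ?_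
      rw [← Finset.mul_sum, hz d hd, mul_comm]
    simpa [hqij, Finset.sum_add_distrib] using this
  have hp0 : 0 < p := by
    have : 0 < (N : ℝ) * p := by rw [e1]; exact mul_pos hn hc
    exact pos_of_mul_pos_right this (by positivity)
  refine ⟨p - q, ?_, fun u v hu hv => ⟨?_, ?_⟩⟩
  · have : 0 < ((N : ℝ) - 1) * (p - q) := by
      have : ((N : ℝ) - 1) * (p - q) = (N - n) * p := by linarith
      rw [this]
      exact mul_pos (by linarith) hp0
    exact pos_of_mul_pos_right this (by linarith)
  · rw [Finset.sum_comm]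
    simp_rw [← Finset.sum_mul, hpi, ← Finset.mul_sum, hu, mul_zero]
  · simp_rw [Finset.sum_mul_sum]
    rw [Finset.sum_comm]
    have : ∀ i, ∑ d ∈ S, ∑ j, z d i * u i * (z d j * v j) = (p - q) * (u i * v i) := by
      intro i
      rw [Finset.sum_comm]
      have : ∀ j, ∑ d ∈ S, z d i * u i * (z d j * v j)
          = q * u i * v j + if i = j then (p - q) * (u i * v j) else 0 := by
        intro j
        have : ∑ d ∈ S, z d i * u i * (z d j * v j)
          = (∑ d ∈ S, z d i * z d j) * (u i * v j) := by
          rw [Finset.sum_mul]; exact Finset.sum_congr rfl fun d _ => by ring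
        rw [this, hqij]
        split_ifs <;> ring
      simp_rw [this, Finset.sum_add_distrib, ← Finset.mul_sum, hv]
      simp
    simp_rw [this, Finset.mul_sum]

lemma assigns_perm {N : ℕ} {𝒢 : Finset Date} {Ng : Date → ℕ} (σ : Equiv.Perm (Fin N))
    (f : (Fin N → 𝒢) → ℝ) :
    ∑ d ∈ assigns N 𝒢 Ng, f (fun i => d (σ i)) = ∑ d ∈ assigns N 𝒢 Ng, f d := by
  have key : ∀ (τ : Equiv.Perm (Fin N)) (d : Fin N → 𝒢), d ∈ assigns N 𝒢 Ng →
      (fun i => d (τ i)) ∈ assigns N 𝒢 Ng := by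
    intro τ d hd
    simp only [assigns, Finset.mem_filter, Finset.mem_univ, true_and] at hd ⊢
    intro g hg
    rw [← hd g hg]
    refine Finset.card_bij (fun i _ => τ i) ?_ ?_ ?_
    · intro i hi; simpa using hi
    · intro i _ j _ h; exact τ.injective h
    · intro j hj; exact ⟨τ.symm j, by simpa using hj, by simp⟩
  refine Finset.sum_bij' (fun d _ => fun i => d (σ i)) (fun d _ => fun i => d (σ.symm i))
    (fun d hd => key σ d hd) (fun d hd => key σ.symm d hd) ?_ ?_ ?_
  · intro d _; funext i; simp
  · intro d _; funext i; simp
  · intro d _; rfl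

lemma exists_perm {N : ℕ} (i j k l : Fin N) (h : i ≠ j) (h' : k ≠ l) :
    ∃ σ : Equiv.Perm (Fin N), σ i = k ∧ σ j = l := by
  refine ⟨(Equiv.swap i k).trans (Equiv.swap (Equiv.swap i k j) l), ?_, ?_⟩
  · simp only [Equiv.trans_apply, Equiv.swap_apply_left]
    refine Equiv.swap_apply_of_ne_of_ne ?_ h'
    intro e
    apply h
    apply (Equiv.swap i k).injective
    rw [← e, Equiv.swap_apply_left]
  · simp

lemma cov_core {α : Type*} (S : Finset α) (hS : S.Nonempty) (N : ℕ) (hN : 2 ≤ N)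
    (n : ℝ) (z : α → Fin N → ℝ) (hz : ∀ d ∈ S, ∑ i, z d i = n) (K : ℝ)
    (hK : ∀ u v : Fin N → ℝ, ∑ i, u i = 0 → ∑ i, v i = 0 →
      (∑ d ∈ S, ∑ i, z d i * u i = 0) ∧
      (∑ d ∈ S, (∑ i, z d i * u i) * (∑ i, z d i * v i) = K * ∑ i, u i * v i))
    (f h : α → ℝ) (u v : Fin N → ℝ) (a b : ℝ)
    (hf : ∀ d ∈ S, f d = ∑ i, z d i * u i + a) (hh : ∀ d ∈ S, h d = ∑ i, z d i * v i + b) :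
    (∑ d ∈ S, (f d - (∑ d ∈ S, f d) / S.card) * (h d - (∑ d ∈ S, h d) / S.card))
      = K * ∑ i, (u i - popMeanS N u) * (v i - popMeanS N v) := by
  have hc : (S.card : ℝ) ≠ 0 := by exact_mod_cast hS.card_pos.ne'
  have hN0 : (N : ℝ) ≠ 0 := by positivity
  have cen : ∀ w : Fin N → ℝ, ∑ i, (w i - popMeanS N w) = 0 := by
    intro w
    simp only [Finset.sum_sub_distrib, popMeanS, Finset.sum_const, Finset.card_univ,
      Fintype.card_fin, nsmul_eq_mul]
    field_simp
    ring
  have main : ∀ (f : α → ℝ) (u : Fin N → ℝ) (a : ℝ), (∀ d ∈ S, f d = ∑ i, z d i * u i + a) →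
      ∀ d ∈ S, f d - (∑ d ∈ S, f d) / S.card = ∑ i, z d i * (u i - popMeanS N u) := by
    intro f u a hf
    have h3 : ∀ d ∈ S, f d = ∑ i, z d i * (u i - popMeanS N u) + (n * popMeanS N u + a) := by
      intro d hd
      rw [hf d hd]
      simp only [mul_sub, Finset.sum_sub_distrib, ← Finset.sum_mul, hz d hd]
      ring
    have h4 : (∑ d ∈ S, f d) / S.card = n * popMeanS N u + a := by
      rw [Finset.sum_congr rfl h3, Finset.sum_add_distrib, (hK _ _ (cen u) (cen u)).1]
      simp only [Finset.sum_const, nsmul_eq_mul]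
      field_simp
      ring
    intro d hd
    rw [h4, h3 d hd]; ring
  rw [← (hK _ _ (cen u) (cen v)).2]
  exact Finset.sum_congr rfl fun d hd => by rw [main f u a hf d hd, main h v b hh d hd]

/-- **two-period optimal coefficient.** In the two-period case `T = 2`,
`𝒢 = {2, ∞}`, under Assumptions 1 and 2, the variance-minimizing coefficient
`β* = Var(X̂)⁻¹ Cov(X̂, θ̂₀)` equals `(N_∞/N)·β_2 + (N_2/N)·β_∞`, where `β_g` is the
finite-population regression coefficient of `Y_{i2}(g)` on the common first-period
outcome `Y_{i1}`. -/
theorem statement17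
    (N2 Ninf : ℕ) (hN2 : 1 ≤ N2) (hNinf : 1 ≤ Ninf)
    (N : ℕ) (hN : N = N2 + Ninf)
    (Ng : Date → ℕ) (hNg2 : Ng ((2 : ℕ) : Date) = N2) (hNgT : Ng (⊤ : Date) = Ninf)
    (Y : Fin N → Date → Fin 2 → ℝ)
    (hNA : ∀ i : Fin N, Y i ((2 : ℕ) : Date) 0 = Y i (⊤ : Date) 0)
    (hs1 : 0 < popVarS N fun i => Y i (⊤ : Date) 0) :
    let 𝒢 : Finset Date := {((2 : ℕ) : Date), (⊤ : Date)}
    let th0 : (Fin N → 𝒢) → ℝ := fun d =>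
      cmean Ng (obs Y d) d ((2 : ℕ) : Date) 1 - cmean Ng (obs Y d) d (⊤ : Date) 1
    let Xh : (Fin N → 𝒢) → ℝ := fun d =>
      cmean Ng (obs Y d) d ((2 : ℕ) : Date) 0 - cmean Ng (obs Y d) d (⊤ : Date) 0
    let βg : Date → ℝ := fun g =>
      ((∑ i, (Y i (⊤ : Date) 0 - popMeanS N fun i' => Y i' (⊤ : Date) 0) *
          (Y i g 1 - popMeanS N fun i' => Y i' g 1)) / ((N : ℝ) - 1)) /
        popVarS N (fun i => Y i (⊤ : Date) 0)
    (varE N 𝒢 Ng Xh)⁻¹ * covE N 𝒢 Ng Xh th0 =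
      ((Ninf : ℝ) / (N : ℝ)) * βg ((2 : ℕ) : Date) +
        ((N2 : ℝ) / (N : ℝ)) * βg (⊤ : Date) := by
  intro 𝒢 th0 Xh βg
  have hne : ((2 : ℕ) : Date) ≠ ⊤ := ENat.natCast_ne_top 2
  have hNge : 2 ≤ N := by omega
  have m2 : ((2 : ℕ) : Date) ∈ 𝒢 := by simp [𝒢]
  have mT : (⊤ : Date) ∈ 𝒢 := by simp [𝒢]
  have hmem : ∀ (d : Fin N → 𝒢) (i : Fin N),
      (d i : Date) = ((2 : ℕ) : Date) ∨ (d i : Date) = ⊤ := by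
    intro d i
    have := (d i).2
    simpa only [𝒢, Finset.mem_insert, Finset.mem_singleton] using this
  set S := assigns N 𝒢 Ng with hSdef
  let z : (Fin N → 𝒢) → Fin N → ℝ := fun d i => if (d i : Date) = ((2 : ℕ) : Date) then 1 else 0
  have hcard : ∀ d ∈ S, ∀ g ∈ 𝒢,
      (Finset.univ.filter fun i => (d i : Date) = g).card = Ng g := by
    intro d hd
    simpa only [hSdef, assigns, Finset.mem_filter, Finset.mem_univ, true_and] using hd
  have hz : ∀ d ∈ S, ∑ i, z d i = (N2 : ℝ) := by
    intro d hd
    have := hcard d hd _ m2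
    rw [hNg2] at this
    rw [← this]
    simp [z]
  have hS : S.Nonempty := by
    obtain ⟨A, -, hA⟩ := Finset.exists_subset_card_eq (s := (Finset.univ : Finset (Fin N)))
      (n := N2) (by simp; omega)
    refine ⟨fun i => if i ∈ A then ⟨_, m2⟩ else ⟨_, mT⟩, ?_⟩
    simp only [hSdef, assigns, Finset.mem_filter, Finset.mem_univ, true_and]
    intro g hg
    have hg' : g = ((2 : ℕ) : Date) ∨ g = ⊤ := by
      simpa only [𝒢, Finset.mem_insert, Finset.mem_singleton] using hg
    rcases hg' with rfl | rfl
    · rw [hNg2, ← hA]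
      congr 1
      ext i
      by_cases hi : i ∈ A
      · simp [hi]
      · simpa [hi] using hne.symm
    · have : (Finset.univ.filter fun i : Fin N =>
          (((if i ∈ A then ⟨_, m2⟩ else ⟨_, mT⟩ : 𝒢)) : Date) = ⊤) = Aᶜ := by
        ext i
        by_cases hi : i ∈ A
        · simpa [hi] using hne
        · simp [hi]
      rw [this, Finset.card_compl, hA, hNgT, Fintype.card_fin]
      omega
  have hn0 : (0 : ℝ) < N2 := by exact_mod_cast hN2
  have hi0 : (0 : ℝ) < Ninf := by exact_mod_cast hNinf
  have hNr : (N : ℝ) = N2 + Ninf := by exact_mod_cast hN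
  obtain ⟨K, hK0, hK⟩ := sum_core S hS N hNge N2 hn0 (by linarith) z hz
    (by intro d i; simp only [z]; split_ifs <;> simp)
    (by
      intro i j
      have := assigns_perm (Ng := Ng) (Equiv.swap i j) (fun d : Fin N → 𝒢 => z d j)
      simpa [z] using this)
    (by
      intro i j k l h h'
      obtain ⟨σ, h1, h2⟩ := exists_perm k l i j h' h
      have := assigns_perm (Ng := Ng) σ (fun d : Fin N → 𝒢 => z d k * z d l)
      simp only [z, h1, h2] at this
      exact this)
  -- representation of difference in means
  have hrep : ∀ (t : Fin 2) (d : Fin N → 𝒢),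
      cmean Ng (obs Y d) d ((2 : ℕ) : Date) t - cmean Ng (obs Y d) d (⊤ : Date) t
      = ∑ i, z d i * (Y i ((2 : ℕ) : Date) t / N2 + Y i ⊤ t / Ninf)
        + (-∑ i, Y i ⊤ t / Ninf) := by
    intro t d
    simp only [cmean, obs, hNg2, hNgT, Finset.sum_div]
    rw [← Finset.sum_sub_distrib, ← Finset.sum_neg_distrib, ← Finset.sum_add_distrib]
    refine Finset.sum_congr rfl fun i _ => ?_
    rcases hmem d i with h | h
    · simp only [z, h, if_true, if_neg hne]; ring
    · simp only [z, h, if_true, if_neg hne.symm]; ring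
  have hcov := cov_core S hS N hNge N2 z hz K hK Xh th0 _ _ _ _
    (fun d _ => hrep 0 d) (fun d _ => hrep 1 d)
  have hvar := cov_core S hS N hNge N2 z hz K hK Xh Xh _ _ _ _
    (fun d _ => hrep 0 d) (fun d _ => hrep 0 d)
  have hc : (S.card : ℝ) ≠ 0 := by exact_mod_cast hS.card_pos.ne'
  have hmean : ∀ t, popMeanS N (fun i => Y i ((2 : ℕ) : Date) t / N2 + Y i ⊤ t / Ninf)
      = popMeanS N (fun i => Y i ((2 : ℕ) : Date) t) / N2
        + popMeanS N (fun i => Y i ⊤ t) / Ninf := by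
    intro t
    simp only [popMeanS, Finset.sum_add_distrib, ← Finset.sum_div]
    ring
  simp only [hmean] at hcov hvar
  simp only [hNA] at hcov hvar
  set m := popMeanS N (fun i => Y i ⊤ 0) with hm
  set m2 := popMeanS N (fun i => Y i ((2 : ℕ) : Date) 1)
  set mi := popMeanS N (fun i => Y i ⊤ 1)
  set V := ∑ i, (Y i ⊤ 0 - m) ^ 2 with hV
  set C2 := ∑ i, (Y i ⊤ 0 - m) * (Y i ((2 : ℕ) : Date) 1 - m2) with hC2
  set Ci := ∑ i, (Y i ⊤ 0 - m) * (Y i ⊤ 1 - mi) with hCi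
  have hN1 : (0 : ℝ) < (N : ℝ) - 1 := by
    have : (2 : ℝ) ≤ N := by exact_mod_cast hNge
    linarith
  have hpv : popVarS N (fun i => Y i ⊤ 0) = V / ((N : ℝ) - 1) := rfl
  have hV0 : 0 < V := by
    rw [hpv] at hs1
    exact (div_pos_iff_of_pos_right hN1).1 hs1
  have hvar' : varE N 𝒢 Ng Xh = K * ((1 / N2 + 1 / Ninf) ^ 2 * V) / S.card := by
    simp only [varE, expec, ← hSdef, pow_two]
    rw [hvar, hV]
    simp only [Finset.mul_sum]
    congr 1
    exact Finset.sum_congr rfl fun i _ => by ring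
  have hcov' : covE N 𝒢 Ng Xh th0
      = K * ((1 / N2 + 1 / Ninf) * (C2 / N2 + Ci / Ninf)) / S.card := by
    simp only [covE, expec, ← hSdef]
    rw [hcov, hC2, hCi, Finset.sum_div, Finset.sum_div, ← Finset.sum_add_distrib]
    simp only [Finset.mul_sum]
    congr 1
    exact Finset.sum_congr rfl fun i _ => by ring
  have hb2 : βg ((2 : ℕ) : Date) = C2 / V := by
    have : βg ((2 : ℕ) : Date) = C2 / ((N : ℝ) - 1) / (V / ((N : ℝ) - 1)) := rfl
    rw [this]; field_simp
  have hbi : βg ⊤ = Ci / V := by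
    have : βg ⊤ = Ci / ((N : ℝ) - 1) / (V / ((N : ℝ) - 1)) := rfl
    rw [this]; field_simp
  rw [hvar', hcov', hb2, hbi, hNr]
  field_simp
  ring

end Staggered
end
end
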